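/- Let n ≥ 2, 1 < p, p̃, p̃₁ < ∞, α < n(p−1). Then the spherical Hardy operator 𝓗 maps the weighted mixed radial-angular space L^p_{rad}L^{p̃₁}_{ang}(ℝⁿ, r^α) to L^p_{rad}L^{p̃}_{ang}(ℝⁿ, r^α) with operator norm exactly ω_n^{1/p̃ − 1/p̃₁} · pn/(pn − n − α). -/

import Mathlib

open MeasureTheory Set ENNReal Metric

/-- The surface measure on the unit sphere `S^{n-1}` in `ℝⁿ`. -/
noncomputable def sphereMeasure (n : ℕ) :
    Measure (sphere (0 : EuclideanSpace ℝ (Fin n)) 1) :=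
  (volume : Measure (EuclideanSpace ℝ (Fin n))).toSphere

/-- The weighted mixed radial-angular norm
`‖f‖_{L^p_{rad}L^{pt}_{ang}(ℝⁿ, r^α)} = (∫₀^∞ ‖f(r·)‖_{L^{pt}(S^{n-1})}^p r^{n-1+α} dr)^{1/p}`. -/
noncomputable def mixedNormW (n : ℕ) (p pt α : ℝ)
    (f : EuclideanSpace ℝ (Fin n) → ℝ) : ℝ≥0∞ :=
  (∫⁻ r in Ioi (0 : ℝ),
    (∫⁻ θ : sphere (0 : EuclideanSpace ℝ (Fin n)) 1,
        ENNReal.ofReal |f (r • (θ : EuclideanSpace ℝ (Fin n)))| ^ pt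
      ∂(sphereMeasure n)) ^ (p / pt) *
      ENNReal.ofReal (r ^ ((n : ℝ) - 1 + α))) ^ (1 / p)
/-- The volume `ν_n` of the unit ball in `ℝⁿ`. -/
noncomputable def nu (n : ℕ) : ℝ :=
  (volume (ball (0 : EuclideanSpace ℝ (Fin n)) 1)).toReal

/-- The spherical Hardy operator `𝓗f(x) = (1/(ν_n|x|ⁿ)) ∫_{|y|≤|x|} f(y) dy`. -/
noncomputable def sphericalHardy (n : ℕ) (f : EuclideanSpace ℝ (Fin n) → ℝ)
    (x : EuclideanSpace ℝ (Fin n)) : ℝ :=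
  (volume (ball (0 : EuclideanSpace ℝ (Fin n)) ‖x‖)).toReal⁻¹ *
    ∫ y in closedBall (0 : EuclideanSpace ℝ (Fin n)) ‖x‖, f y

lemma polar_aux (n : ℕ) (hn : 1 ≤ n) (g : EuclideanSpace ℝ (Fin n) → ℝ≥0∞) (hg : Measurable g) :
    ∫⁻ y, g y = ∫⁻ r in Ioi (0 : ℝ),
      (∫⁻ θ : sphere (0 : EuclideanSpace ℝ (Fin n)) 1,
        g (r • (θ : EuclideanSpace ℝ (Fin n))) ∂(sphereMeasure n)) * ENNReal.ofReal (r ^ (n - 1)) := by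
  have : Nonempty (Fin n) := ⟨⟨0, hn⟩⟩
  have hdim : Module.finrank ℝ (EuclideanSpace ℝ (Fin n)) = n := by simp
  have hmp := (volume : Measure (EuclideanSpace ℝ (Fin n))).measurePreserving_homeomorphUnitSphereProd
  rw [hdim] at hmp
  have hgm : Measurable (fun q : sphere (0 : EuclideanSpace ℝ (Fin n)) 1 × Ioi (0 : ℝ) => g ((q.2 : ℝ) • (q.1 : EuclideanSpace ℝ (Fin n)))) := by
    fun_prop
  have hgm' : Measurable (fun q : Ioi (0 : ℝ) × sphere (0 : EuclideanSpace ℝ (Fin n)) 1 => g ((q.1 : ℝ) • (q.2 : EuclideanSpace ℝ (Fin n)))) := by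
    fun_prop
  calc ∫⁻ y, g y = ∫⁻ x : ({(0 : EuclideanSpace ℝ (Fin n))}ᶜ : Set (EuclideanSpace ℝ (Fin n))), g x.1 ∂((volume : Measure (EuclideanSpace ℝ (Fin n))).comap (↑)) := by
        rw [lintegral_subtype_comap (measurableSet_singleton (0 : EuclideanSpace ℝ (Fin n))).compl g,
          restrict_compl_singleton]
    _ = ∫⁻ q, g ((q.2 : ℝ) • (q.1 : EuclideanSpace ℝ (Fin n))) ∂((volume : Measure (EuclideanSpace ℝ (Fin n))).toSphere.prod
          (.volumeIoiPow (n - 1))) := by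
        rw [← hmp.lintegral_comp_emb (Homeomorph.measurableEmbedding _)]
        refine lintegral_congr fun x => ?_
        congr 1
        have : ‖(x : EuclideanSpace ℝ (Fin n))‖ ≠ 0 := norm_ne_zero_iff.2 x.2
        simp [smul_smul, this]
    _ = ∫⁻ r : Ioi (0 : ℝ), ∫⁻ θ : sphere (0 : EuclideanSpace ℝ (Fin n)) 1, g ((r : ℝ) • (θ : EuclideanSpace ℝ (Fin n)))
          ∂((volume : Measure (EuclideanSpace ℝ (Fin n))).toSphere) ∂(Measure.volumeIoiPow (n - 1)) := by
        rw [lintegral_prod_symm _ hgm.aemeasurable]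
    _ = _ := by
        rw [Measure.volumeIoiPow, lintegral_withDensity_eq_lintegral_mul _ (by fun_prop)
          (hgm'.lintegral_prod_right')]
        rw [← lintegral_subtype_comap measurableSet_Ioi]
        refine lintegral_congr fun r => ?_
        simp only [Pi.mul_apply, sphereMeasure]
        rw [mul_comm]

lemma scale_aux (h : ℝ → ℝ≥0∞) (hh : Measurable h) (t : ℝ) (ht : 0 < t) :
    ∫⁻ r in Ioi (0 : ℝ), h (t * r) = ENNReal.ofReal t⁻¹ * ∫⁻ r in Ioi (0 : ℝ), h r := by
  have h1 := Real.map_volume_mul_left ht.ne'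
  rw [abs_of_pos (inv_pos.2 ht)] at h1
  rw [← lintegral_indicator measurableSet_Ioi, ← lintegral_indicator measurableSet_Ioi,
    ← smul_eq_mul (a := ENNReal.ofReal t⁻¹), ← lintegral_smul_measure, ← h1,
    lintegral_map (hh.indicator measurableSet_Ioi) (by fun_prop)]
  refine lintegral_congr fun r => ?_
  by_cases hr : 0 < r
  · simp [indicator, hr, ht]
  · simp [indicator, hr, mul_pos_iff_of_pos_left ht]

lemma jensen_aux {X : Type*} [MeasurableSpace X] (μ : Measure X) (G : X → ℝ≥0∞)
    (hG : AEMeasurable G μ) (p : ℝ) (hp : 1 < p) :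
    (∫⁻ x, G x ∂μ) ^ p ≤ μ univ ^ (p - 1) * ∫⁻ x, G x ^ p ∂μ := by
  have hpq := Real.HolderConjugate.conjExponent hp
  have h := ENNReal.lintegral_mul_le_Lp_mul_Lq μ hpq hG (aemeasurable_const (b := (1 : ℝ≥0∞)))
  simp only [Pi.mul_apply, mul_one, ENNReal.one_rpow, lintegral_const, one_mul] at h
  have hp0 : 0 < p := by linarith
  calc (∫⁻ x, G x ∂μ) ^ p ≤ ((∫⁻ x, G x ^ p ∂μ) ^ (1 / p) * μ univ ^ (1 / p.conjExponent)) ^ p := by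
        gcongr
    _ = μ univ ^ (p - 1) * ∫⁻ x, G x ^ p ∂μ := by
        rw [ENNReal.mul_rpow_of_nonneg _ _ hp0.le, ← ENNReal.rpow_mul, ← ENNReal.rpow_mul,
          mul_comm]
        congr 2
        · rw [Real.conjExponent]
          field_simp
        · rw [one_div, inv_mul_cancel₀ hp0.ne', ENNReal.rpow_one]

lemma lint_rpow_aux (s : ℝ) (hs : -1 < s) :
    ∫⁻ t in Ioc (0 : ℝ) 1, ENNReal.ofReal (t ^ s) = ENNReal.ofReal (1 / (s + 1)) := by
  have h2 : ∫ t in Ioc (0 : ℝ) 1, t ^ s = 1 / (s + 1) := by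
    rw [← intervalIntegral.integral_of_le zero_le_one, integral_rpow (Or.inl hs),
      Real.zero_rpow (by linarith)]
    simp
  have h1 : IntegrableOn (fun t : ℝ => t ^ s) (Ioc 0 1) :=
    (intervalIntegrable_iff_integrableOn_Ioc_of_le zero_le_one).1
      (intervalIntegral.intervalIntegrable_rpow' hs)
  rw [← h2, ofReal_integral_eq_lintegral_ofReal h1]
  filter_upwards [ae_restrict_mem measurableSet_Ioc] with y hy
  exact Real.rpow_nonneg hy.1.le _

lemma hardy_aux (F : ℝ → ℝ≥0∞) (hF : Measurable F) (d p α : ℝ) (hp : 1 < p)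
    (hα : α < d * (p - 1)) :
    ∫⁻ r in Ioi (0 : ℝ), (∫⁻ t in Ioc (0 : ℝ) 1, F (r * t) * ENNReal.ofReal (t ^ (d - 1))) ^ p *
        ENNReal.ofReal (r ^ (d - 1 + α))
      ≤ ENNReal.ofReal (1 / (d - (d + α) / p)) ^ p *
        ∫⁻ r in Ioi (0 : ℝ), F r ^ p * ENNReal.ofReal (r ^ (d - 1 + α)) := by
  have hp0 : 0 < p := by linarith
  set β := (d + α) / p with hβ
  have hβp : β * p = d + α := by rw [hβ]; field_simp
  have hβd : 0 < d - β := by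
    rw [sub_pos, hβ, div_lt_iff₀ hp0]; linarith
  set A := ENNReal.ofReal (1 / (d - β)) with hA
  set N := ∫⁻ r in Ioi (0 : ℝ), F r ^ p * ENNReal.ofReal (r ^ (d - 1 + α)) with hN
  set w : ℝ → ℝ≥0∞ := fun t => ENNReal.ofReal (t ^ (d - 1 - β)) with hw
  have hwm : Measurable w := by fun_prop
  set μ : Measure ℝ := (volume.restrict (Ioc (0 : ℝ) 1)).withDensity w with hμ
  have hμu : μ univ = A := by
    rw [hμ, withDensity_apply _ MeasurableSet.univ, Measure.restrict_univ, hw,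
      lint_rpow_aux _ (by linarith), hA]
    congr 2; ring
  have step1 : ∀ r : ℝ, (∫⁻ t in Ioc (0 : ℝ) 1, F (r * t) * ENNReal.ofReal (t ^ (d - 1))) ^ p
      ≤ A ^ (p - 1) * ∫⁻ t in Ioc (0 : ℝ) 1,
        w t * (F (r * t) * ENNReal.ofReal (t ^ β)) ^ p := by
    intro r
    have hGm : Measurable (fun t => F (r * t) * ENNReal.ofReal (t ^ β)) := by fun_prop
    have h := jensen_aux μ (fun t => F (r * t) * ENNReal.ofReal (t ^ β)) hGm.aemeasurable p hp
    rw [hμu, hμ, lintegral_withDensity_eq_lintegral_mul _ hwm hGm,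
      lintegral_withDensity_eq_lintegral_mul _ hwm (hGm.pow_const p)] at h
    refine le_trans (le_of_eq ?_) h
    congr 1
    refine setLIntegral_congr_fun measurableSet_Ioc fun t ht => ?_
    simp only [Pi.mul_apply, hw]
    rw [mul_left_comm, ← ENNReal.ofReal_mul (Real.rpow_nonneg ht.1.le _), ← Real.rpow_add ht.1]
    congr 3; ring
  calc _ ≤ ∫⁻ r in Ioi (0 : ℝ), (A ^ (p - 1) * ∫⁻ t in Ioc (0 : ℝ) 1,
        w t * (F (r * t) * ENNReal.ofReal (t ^ β)) ^ p) * ENNReal.ofReal (r ^ (d - 1 + α)) := by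
        gcongr with r
        exact step1 r
    _ = A ^ (p - 1) * ∫⁻ r in Ioi (0 : ℝ), ∫⁻ t in Ioc (0 : ℝ) 1,
        w t * (F (r * t) * ENNReal.ofReal (t ^ β)) ^ p * ENNReal.ofReal (r ^ (d - 1 + α)) := by
        rw [← lintegral_const_mul]
        · refine lintegral_congr fun r => ?_
          rw [mul_assoc, lintegral_mul_const _ (by fun_prop)]
        · apply Measurable.lintegral_prod_right'
            (f := fun q : ℝ × ℝ => w q.2 * (F (q.1 * q.2) * ENNReal.ofReal (q.2 ^ β)) ^ p *
              ENNReal.ofReal (q.1 ^ (d - 1 + α)))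
          fun_prop
    _ = A ^ (p - 1) * ∫⁻ t in Ioc (0 : ℝ) 1, ∫⁻ r in Ioi (0 : ℝ),
        w t * (F (r * t) * ENNReal.ofReal (t ^ β)) ^ p * ENNReal.ofReal (r ^ (d - 1 + α)) := by
        rw [lintegral_lintegral_swap]
        apply Measurable.aemeasurable
        simp only [Function.uncurry_def]
        fun_prop
    _ = A ^ (p - 1) * ∫⁻ t in Ioc (0 : ℝ) 1, w t * N := by
        congr 1
        refine setLIntegral_congr_fun measurableSet_Ioc fun t ht => ?_
        have ht0 : 0 < t := ht.1
        have hc := scale_aux (fun s => F s ^ p * ENNReal.ofReal (s ^ (d - 1 + α)))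
          (by fun_prop) t ht0
        calc _ = ∫⁻ r in Ioi (0 : ℝ), (w t * ENNReal.ofReal t) *
              (F (t * r) ^ p * ENNReal.ofReal ((t * r) ^ (d - 1 + α))) := by
              refine setLIntegral_congr_fun measurableSet_Ioi fun r hr => ?_
              have hr0 : 0 < r := hr
              rw [ENNReal.mul_rpow_of_nonneg _ _ hp0.le, Real.mul_rpow ht0.le hr0.le,
                ENNReal.ofReal_rpow_of_nonneg (Real.rpow_nonneg ht0.le _) hp0.le,
                ← Real.rpow_mul ht0.le, hβp, ENNReal.ofReal_mul (Real.rpow_nonneg ht0.le _)]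
              have : ENNReal.ofReal (t ^ (d + α)) =
                  ENNReal.ofReal t * ENNReal.ofReal (t ^ (d - 1 + α)) := by
                rw [← ENNReal.ofReal_mul ht0.le]
                rw [show d + α = 1 + (d - 1 + α) by ring, Real.rpow_add ht0, Real.rpow_one]
              rw [this, mul_comm r t]
              ring
          _ = _ := by
              rw [lintegral_const_mul _ (by fun_prop), hc, ← hN]
              rw [← mul_assoc, mul_assoc (w t), ← ENNReal.ofReal_mul ht0.le,
                mul_inv_cancel₀ ht0.ne']
              simp
    _ = A ^ p * N := by
        rw [lintegral_mul_const _ hwm, hw, lint_rpow_aux _ (by linarith),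
          show d - 1 - β + 1 = d - β by ring, ← hA, ← mul_assoc]
        congr 1
        have hA0 : A ≠ 0 := by
          rw [hA]; simpa using hβd
        conv_lhs => rw [← ENNReal.rpow_one A, ← ENNReal.rpow_mul, one_mul]
        rw [← ENNReal.rpow_add _ _ hA0 (by simp [hA])]
        congr 1; ring

lemma sphere_univ (n : ℕ) : sphereMeasure n univ = ENNReal.ofReal (n * nu n) := by
  rw [sphereMeasure, Measure.toSphere_apply_univ, nu, ENNReal.ofReal_mul (by positivity),
    ENNReal.ofReal_toReal measure_ball_lt_top.ne]
  simp

lemma nu_pos (n : ℕ) : 0 < nu n :=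
  ENNReal.toReal_pos (measure_ball_pos _ _ one_pos).ne' measure_ball_lt_top.ne

lemma ball_vol (n : ℕ) (r : ℝ) (hr : 0 < r) :
    (volume (ball (0 : EuclideanSpace ℝ (Fin n)) r)).toReal = r ^ n * nu n := by
  rw [Measure.addHaar_ball_of_pos _ _ hr, ENNReal.toReal_mul,
    ENNReal.toReal_ofReal (by positivity), nu]
  simp

lemma norm_smul_sphere (n : ℕ) (r : ℝ) (hr : 0 < r)
    (θ : sphere (0 : EuclideanSpace ℝ (Fin n)) 1) :
    ‖r • (θ : EuclideanSpace ℝ (Fin n))‖ = r := by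
  rw [norm_smul, norm_eq_of_mem_sphere, mul_one, Real.norm_of_nonneg hr.le]

/-- Averages over balls in polar coordinates. -/
lemma hardy_pointwise (n : ℕ) (hn : 1 ≤ n) (f : EuclideanSpace ℝ (Fin n) → ℝ) (hf : Measurable f)
    (x : EuclideanSpace ℝ (Fin n)) (r : ℝ) (hr : 0 < r) (hx : ‖x‖ = r) :
    ENNReal.ofReal |sphericalHardy n f x| ≤ ENNReal.ofReal (nu n)⁻¹ *
      ∫⁻ t in Ioc (0 : ℝ) 1, (∫⁻ θ : sphere (0 : EuclideanSpace ℝ (Fin n)) 1,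
        ENNReal.ofReal |f ((r * t) • (θ : EuclideanSpace ℝ (Fin n)))| ∂(sphereMeasure n)) *
        ENNReal.ofReal (t ^ ((n : ℝ) - 1)) := by
  set F : ℝ → ℝ≥0∞ := fun s => ∫⁻ θ : sphere (0 : EuclideanSpace ℝ (Fin n)) 1,
        ENNReal.ofReal |f (s • (θ : EuclideanSpace ℝ (Fin n)))| ∂(sphereMeasure n) with hF
  have : IsFiniteMeasure (sphereMeasure n) := by unfold sphereMeasure; infer_instance
  have hFm : Measurable F := by
    apply Measurable.lintegral_prod_right' (f := fun q : ℝ × sphere (0 : EuclideanSpace ℝ (Fin n)) 1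
      => ENNReal.ofReal |f (q.1 • (q.2 : EuclideanSpace ℝ (Fin n)))|)
    have : Measurable (fun q : ℝ × sphere (0 : EuclideanSpace ℝ (Fin n)) 1
      => f (q.1 • (q.2 : EuclideanSpace ℝ (Fin n)))) := hf.comp (by fun_prop)
    exact (continuous_abs.measurable.comp this).ennreal_ofReal
  have h1 : ∫⁻ y in closedBall (0 : EuclideanSpace ℝ (Fin n)) r, ENNReal.ofReal |f y|
      = ENNReal.ofReal (r ^ n) *
        ∫⁻ t in Ioc (0 : ℝ) 1, F (r * t) * ENNReal.ofReal (t ^ ((n : ℝ) - 1)) := by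
    rw [← lintegral_indicator measurableSet_closedBall, polar_aux n hn
      ((closedBall 0 r).indicator fun y => ENNReal.ofReal |f y|) ((continuous_abs.measurable.comp hf).ennreal_ofReal.indicator measurableSet_closedBall)]
    have h2 := scale_aux (fun s => (Iic r).indicator (fun s => F s * ENNReal.ofReal (s ^ (n - 1))) s)
      ((by fun_prop : Measurable (fun s => F s * ENNReal.ofReal (s ^ (n - 1)))).indicator
        measurableSet_Iic) r hr
    calc _ = ∫⁻ s in Ioi (0 : ℝ), (Iic r).indicator (fun s => F s * ENNReal.ofReal (s ^ (n - 1))) s := by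
          refine setLIntegral_congr_fun measurableSet_Ioi fun s hs => ?_
          have hs0 : 0 < s := hs
          by_cases hsr : s ≤ r
          · simp [indicator, norm_smul, abs_of_pos hs0, hsr, hF]
          · simp [indicator, norm_smul, abs_of_pos hs0, hsr]
      _ = ENNReal.ofReal r * ∫⁻ t in Ioi (0 : ℝ),
            (Iic r).indicator (fun s => F s * ENNReal.ofReal (s ^ (n - 1))) (r * t) := by
          rw [h2, ← mul_assoc, ← ENNReal.ofReal_mul hr.le, mul_inv_cancel₀ hr.ne']
          simp
      _ = ENNReal.ofReal r * ∫⁻ t in Ioi (0 : ℝ), (Iic (1 : ℝ)).indicator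
            (fun t => ENNReal.ofReal (r ^ (n - 1)) *
              (F (r * t) * ENNReal.ofReal (t ^ ((n : ℝ) - 1)))) t := by
          congr 1
          refine setLIntegral_congr_fun measurableSet_Ioi fun t ht => ?_
          have ht0 : 0 < t := ht
          have hpow : t ^ ((n : ℝ) - 1) = t ^ (n - 1) := by
            rw [← Real.rpow_natCast, Nat.cast_sub hn, Nat.cast_one]
          by_cases ht1 : t ≤ 1
          · have : r * t ≤ r := by nlinarith
            simp only [indicator, mem_Iic, ht1, this, if_true]
            rw [mul_pow, ENNReal.ofReal_mul (by positivity), hpow]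
            ring
          · have : ¬ r * t ≤ r := by nlinarith
            simp only [indicator, mem_Iic, ht1, this, if_false]
      _ = _ := by
          rw [lintegral_indicator measurableSet_Iic, Measure.restrict_restrict measurableSet_Iic,
            inter_comm, Ioi_inter_Iic, lintegral_const_mul _ (by fun_prop), ← mul_assoc,
            ← ENNReal.ofReal_mul hr.le, mul_pow_sub_one (by omega)]
  have h3 : ENNReal.ofReal |∫ y in closedBall (0 : EuclideanSpace ℝ (Fin n)) r, f y|
      ≤ ∫⁻ y in closedBall (0 : EuclideanSpace ℝ (Fin n)) r, ENNReal.ofReal |f y| := by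
    have := enorm_integral_le_lintegral_enorm (μ := volume.restrict
      (closedBall (0 : EuclideanSpace ℝ (Fin n)) r)) f
    simpa only [Real.enorm_eq_ofReal_abs] using this
  have hv : 0 < r ^ n * nu n := mul_pos (by positivity) (nu_pos n)
  rw [sphericalHardy, hx, ball_vol n r hr, abs_mul, abs_of_pos (inv_pos.2 hv),
    ENNReal.ofReal_mul (inv_pos.2 hv).le]
  refine (mul_le_mul_right (h3.trans h1.le) _).trans (le_of_eq ?_)
  rw [← mul_assoc, ← ENNReal.ofReal_mul (inv_pos.2 hv).le]
  congr 2
  have := nu_pos n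
  field_simp

lemma const_aux (w v A pt pt₁ p m : ℝ) (hv : 0 < v) (hm : 0 < m) (hw : w = m * v) (hA : 0 < A)
    (hp : 0 < p) (N : ℝ≥0∞) :
    (ENNReal.ofReal w ^ (p / pt) * (ENNReal.ofReal v⁻¹ ^ p * (ENNReal.ofReal A ^ p *
      (ENNReal.ofReal w ^ (p - p / pt₁) * N)))) ^ (1 / p)
    = ENNReal.ofReal (w ^ (1 / pt - 1 / pt₁) * (m * A)) * N ^ (1 / p) := by
  have hw0 : 0 < w := by rw [hw]; positivity
  have h1p : 0 ≤ 1 / p := by positivity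
  have hc : ENNReal.ofReal (w ^ (1 / pt - 1 / pt₁) * (m * A)) =
      ENNReal.ofReal (w ^ (1 / pt)) * (ENNReal.ofReal v⁻¹ * (ENNReal.ofReal A *
        ENNReal.ofReal (w ^ (1 - 1 / pt₁)))) := by
    rw [← ENNReal.ofReal_mul hA.le, ← ENNReal.ofReal_mul (by positivity),
      ← ENNReal.ofReal_mul (by positivity)]
    congr 1
    have : w ^ (1 / pt - 1 / pt₁) * w = w ^ (1 / pt) * w ^ (1 - 1 / pt₁) := by
      rw [← Real.rpow_add hw0, ← Real.rpow_add_one hw0.ne']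
      congr 1; ring
    have hm' : m = w * v⁻¹ := by rw [hw]; field_simp
    rw [hm']
    linear_combination (v⁻¹ * A) * this
  rw [hc, ENNReal.mul_rpow_of_nonneg _ _ h1p, ENNReal.mul_rpow_of_nonneg _ _ h1p,
    ENNReal.mul_rpow_of_nonneg _ _ h1p, ENNReal.mul_rpow_of_nonneg _ _ h1p,
    ← ENNReal.rpow_mul, ← ENNReal.rpow_mul, ← ENNReal.rpow_mul, ← ENNReal.rpow_mul,
    mul_one_div_cancel hp.ne', ENNReal.rpow_one, ENNReal.rpow_one,
    ENNReal.ofReal_rpow_of_pos hw0, ENNReal.ofReal_rpow_of_pos hw0]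
  rw [show p / pt * (1 / p) = 1 / pt by field_simp,
    show (p - p / pt₁) * (1 / p) = 1 - 1 / pt₁ by field_simp]
  ring

lemma upper_aux (n : ℕ) (hn : 2 ≤ n) (p pt pt₁ α : ℝ)
    (hp : 1 < p) (hpt : 1 < pt) (hpt₁ : 1 < pt₁) (hα : α < n * (p - 1))
    (f : EuclideanSpace ℝ (Fin n) → ℝ) (hf : Measurable f) :
      mixedNormW n p pt α (sphericalHardy n f)
        ≤ ENNReal.ofReal ((n * nu n) ^ (1 / pt - 1 / pt₁) *
            (p * n / (p * n - n - α))) * mixedNormW n p pt₁ α f := by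
  have hp0 : 0 < p := by linarith
  have hn0 : (0 : ℝ) < n := by positivity
  set F : ℝ → ℝ≥0∞ := fun s => ∫⁻ θ : sphere (0 : EuclideanSpace ℝ (Fin n)) 1,
        ENNReal.ofReal |f (s • (θ : EuclideanSpace ℝ (Fin n)))| ∂(sphereMeasure n) with hF
  have : IsFiniteMeasure (sphereMeasure n) := by unfold sphereMeasure; infer_instance
  have hfm : Measurable fun q : ℝ × sphere (0 : EuclideanSpace ℝ (Fin n)) 1
      => ENNReal.ofReal |f (q.1 • (q.2 : EuclideanSpace ℝ (Fin n)))| := by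
    have : Measurable (fun q : ℝ × sphere (0 : EuclideanSpace ℝ (Fin n)) 1
      => f (q.1 • (q.2 : EuclideanSpace ℝ (Fin n)))) := hf.comp (by fun_prop)
    exact (continuous_abs.measurable.comp this).ennreal_ofReal
  have hFm : Measurable F := hfm.lintegral_prod_right'
  have hMm : Measurable fun r : ℝ => ∫⁻ θ : sphere (0 : EuclideanSpace ℝ (Fin n)) 1,
        ENNReal.ofReal |f (r • (θ : EuclideanSpace ℝ (Fin n)))| ^ pt₁ ∂(sphereMeasure n) :=
    (hfm.pow_const pt₁).lintegral_prod_right'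
  set w : ℝ := n * nu n with hw
  have hw0 : 0 < w := mul_pos hn0 (nu_pos n)
  have hA : 0 < n - (n + α) / p := by
    rw [sub_pos, div_lt_iff₀ hp0]; linarith
  set A := 1 / (n - (n + α) / p) with hAdef
  have hA0 : 0 < A := by positivity
  have hK : p * n / (p * n - n - α) = n * A := by
    rw [hAdef]
    have : p * n - n - α = p * (n - (n + α) / p) := by field_simp; ring
    rw [this]; field_simp
  rw [hK, mixedNormW, mixedNormW, ← const_aux w (nu n) A pt pt₁ p n (nu_pos n) hn0 hw hA0 hp0]
  refine ENNReal.rpow_le_rpow ?_ (by positivity)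
  have hinner : ∀ r : ℝ, F r ^ p ≤ ENNReal.ofReal w ^ (p - p / pt₁) *
      (∫⁻ θ : sphere (0 : EuclideanSpace ℝ (Fin n)) 1,
        ENNReal.ofReal |f (r • (θ : EuclideanSpace ℝ (Fin n)))| ^ pt₁ ∂(sphereMeasure n)) ^ (p / pt₁) := by
    intro r
    have h := jensen_aux (sphereMeasure n) (fun θ : sphere (0 : EuclideanSpace ℝ (Fin n)) 1 =>
      ENNReal.ofReal |f (r • (θ : EuclideanSpace ℝ (Fin n)))|)
      (hfm.comp measurable_prodMk_left).aemeasurable pt₁ hpt₁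
    have h2 := ENNReal.rpow_le_rpow h (by positivity : 0 ≤ p / pt₁)
    rw [ENNReal.mul_rpow_of_nonneg _ _ (by positivity), ← ENNReal.rpow_mul, ← ENNReal.rpow_mul,
      sphere_univ, mul_div_cancel₀ _ (by positivity)] at h2
    refine h2.trans (le_of_eq ?_)
    congr 2
    field_simp
  calc _ ≤ ∫⁻ r in Ioi (0 : ℝ), (ENNReal.ofReal w ^ (p / pt) * ENNReal.ofReal (nu n)⁻¹ ^ p) *
        ((∫⁻ t in Ioc (0 : ℝ) 1, F (r * t) * ENNReal.ofReal (t ^ ((n : ℝ) - 1))) ^ p *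
          ENNReal.ofReal (r ^ ((n : ℝ) - 1 + α))) := by
        refine setLIntegral_mono' measurableSet_Ioi fun r hr => ?_
        rw [← mul_assoc]
        refine mul_le_mul_left ?_ _
        set c := ENNReal.ofReal (nu n)⁻¹ *
          ∫⁻ t in Ioc (0 : ℝ) 1, F (r * t) * ENNReal.ofReal (t ^ ((n : ℝ) - 1)) with hc
        calc _ ≤ (∫⁻ θ : sphere (0 : EuclideanSpace ℝ (Fin n)) 1, c ^ pt ∂(sphereMeasure n)) ^ (p / pt) := by
              gcongr with θ
              exact hardy_pointwise n (by omega) f hf _ r hr (norm_smul_sphere n r hr θ)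
          _ = _ := by
              rw [lintegral_const, sphere_univ, ENNReal.mul_rpow_of_nonneg _ _ (by positivity),
                ← ENNReal.rpow_mul, mul_div_cancel₀ _ (by positivity), hc,
                ENNReal.mul_rpow_of_nonneg _ _ hp0.le]
              ring
    _ ≤ (ENNReal.ofReal w ^ (p / pt) * ENNReal.ofReal (nu n)⁻¹ ^ p) *
        (ENNReal.ofReal A ^ p *
        ∫⁻ r in Ioi (0 : ℝ), F r ^ p * ENNReal.ofReal (r ^ ((n : ℝ) - 1 + α))) := by
        rw [lintegral_const_mul']
        · exact mul_le_mul_right (hardy_aux F hFm n p α hp hα) _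
        · refine ENNReal.mul_ne_top ?_ ?_ <;>
          exact ENNReal.rpow_ne_top_of_nonneg (by positivity) ENNReal.ofReal_ne_top
    _ ≤ _ := by
        rw [mul_assoc]
        refine mul_le_mul_right (mul_le_mul_right (mul_le_mul_right ?_ _) _) _
        rw [← lintegral_const_mul _ (by fun_prop)]
        refine lintegral_mono fun r => ?_
        rw [← mul_assoc]
        exact mul_le_mul_left (hinner r) _

lemma radial_norm (n : ℕ) (p q α : ℝ) (hp : 0 < p) (hq : 0 < q)
    (f : EuclideanSpace ℝ (Fin n) → ℝ) (g : ℝ → ℝ) (hfg : ∀ x, f x = g ‖x‖) :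
    mixedNormW n p q α f = ENNReal.ofReal (n * nu n) ^ (1 / q) *
      (∫⁻ r in Ioi (0 : ℝ), ENNReal.ofReal |g r| ^ p *
        ENNReal.ofReal (r ^ ((n : ℝ) - 1 + α))) ^ (1 / p) := by
  have h1 : ∫⁻ r in Ioi (0 : ℝ),
    (∫⁻ θ : sphere (0 : EuclideanSpace ℝ (Fin n)) 1,
        ENNReal.ofReal |f (r • (θ : EuclideanSpace ℝ (Fin n)))| ^ q
      ∂(sphereMeasure n)) ^ (p / q) * ENNReal.ofReal (r ^ ((n : ℝ) - 1 + α)) =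
      ∫⁻ r in Ioi (0 : ℝ), ENNReal.ofReal (n * nu n) ^ (p / q) * (ENNReal.ofReal |g r| ^ p *
        ENNReal.ofReal (r ^ ((n : ℝ) - 1 + α))) := by
    refine setLIntegral_congr_fun measurableSet_Ioi fun r hr => ?_
    have h2 : ∀ θ : sphere (0 : EuclideanSpace ℝ (Fin n)) 1,
        f (r • (θ : EuclideanSpace ℝ (Fin n))) = g r := fun θ => by
      rw [hfg, norm_smul_sphere n r hr θ]
    simp only [h2, lintegral_const, sphere_univ]
    rw [ENNReal.mul_rpow_of_nonneg _ _ (by positivity), ← ENNReal.rpow_mul,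
      mul_div_cancel₀ _ hq.ne']
    ring
  rw [mixedNormW, h1, lintegral_const_mul', ENNReal.mul_rpow_of_nonneg _ _ (by positivity),
    ← ENNReal.rpow_mul]
  · congr 2
    field_simp
  · exact ENNReal.rpow_ne_top_of_nonneg (by positivity) ENNReal.ofReal_ne_top

lemma mixed_mono (n : ℕ) (p q α : ℝ) (hp : 0 < p) (hq : 0 < q)
    (f g : EuclideanSpace ℝ (Fin n) → ℝ) (hfg : ∀ x, 0 < ‖x‖ → |f x| ≤ |g x|) :
    mixedNormW n p q α f ≤ mixedNormW n p q α g := by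
  rw [mixedNormW, mixedNormW]
  refine ENNReal.rpow_le_rpow ?_ (by positivity)
  refine setLIntegral_mono' measurableSet_Ioi fun r hr => ?_
  refine mul_le_mul_left (ENNReal.rpow_le_rpow (lintegral_mono fun θ => ENNReal.rpow_le_rpow
    (ENNReal.ofReal_le_ofReal ?_) hq.le) (by positivity)) _
  apply hfg
  rw [norm_smul_sphere n r hr θ]
  exact hr

lemma hardy_power (n : ℕ) (hn : 1 ≤ n) (γ : ℝ) (hγ : γ < n) (x : EuclideanSpace ℝ (Fin n))
    (hx : 0 < ‖x‖) (hx1 : ‖x‖ ≤ 1) :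
    sphericalHardy n (fun y => (Iic (1 : ℝ)).indicator (fun r => r ^ (-γ)) ‖y‖) x
      = n / (n - γ) * ‖x‖ ^ (-γ) := by
  have : Nonempty (Fin n) := ⟨⟨0, hn⟩⟩
  have hnu := nu_pos n
  have hd : 0 < n - γ := by linarith
  have h1 : ∫ y in closedBall (0 : EuclideanSpace ℝ (Fin n)) ‖x‖,
      (Iic (1 : ℝ)).indicator (fun r => r ^ (-γ)) ‖y‖ =
      n * (nu n * (‖x‖ ^ (n - γ) / (n - γ))) := by
    rw [← integral_indicator measurableSet_closedBall]
    calc _ = ∫ y : EuclideanSpace ℝ (Fin n), (Iic ‖x‖).indicator (fun r => r ^ (-γ)) ‖y‖ := by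
          refine integral_congr_ae (.of_forall fun y => ?_)
          by_cases hy : ‖y‖ ≤ ‖x‖
          · simp [indicator, hy, hy.trans hx1]
          · simp [indicator, hy]
      _ = _ := by
          rw [integral_fun_norm_addHaar]
          simp only [finrank_euclideanSpace, Fintype.card_fin, nsmul_eq_mul, smul_eq_mul]
          congr 2
          calc _ = ∫ r in Ioi (0 : ℝ), (Iic ‖x‖).indicator (fun r => r ^ (n - 1 - γ)) r := by
                refine setIntegral_congr_fun measurableSet_Ioi fun r hr => ?_
                have hr0 : 0 < r := hr
                by_cases h : r ≤ ‖x‖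
                · simp only [indicator, mem_Iic, h, if_true]
                  rw [← Real.rpow_natCast, ← Real.rpow_add hr0, Nat.cast_sub hn, Nat.cast_one]
                  congr 1
                · simp [indicator, h]
            _ = _ := by
                rw [integral_indicator measurableSet_Iic,
                  Measure.restrict_restrict measurableSet_Iic, inter_comm, Ioi_inter_Iic,
                  ← intervalIntegral.integral_of_le hx.le, integral_rpow (Or.inl (by linarith)),
                  Real.zero_rpow (by linarith), show (n : ℝ) - 1 - γ + 1 = n - γ by ring, sub_zero]
  rw [sphericalHardy, h1, ball_vol n _ hx, sub_eq_add_neg (n : ℝ) γ, Real.rpow_add hx,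
    Real.rpow_natCast]
  rw [sub_eq_add_neg] at hd
  field_simp

lemma lower_aux (n : ℕ) (hn : 2 ≤ n) (p pt pt₁ α : ℝ)
    (hp : 1 < p) (hpt : 1 < pt) (hpt₁ : 1 < pt₁) (hα : α < n * (p - 1)) (C : ℝ≥0∞)
    (hC : ∀ f : EuclideanSpace ℝ (Fin n) → ℝ, Measurable f → mixedNormW n p pt₁ α f < ⊤ →
        mixedNormW n p pt α (sphericalHardy n f) ≤ C * mixedNormW n p pt₁ α f)
    (ε : ℝ) (hε : 0 < ε) :
    ENNReal.ofReal ((n * nu n) ^ (1 / pt - 1 / pt₁) *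
          (n / (n - (n + α) / p + ε))) ≤ C := by
  have hp0 : 0 < p := by linarith
  have hpt0 : 0 < pt := by linarith
  have hpt₁0 : 0 < pt₁ := by linarith
  have hn0 : (0 : ℝ) < n := by positivity
  set w : ℝ := n * nu n with hw
  have hw0 : 0 < w := mul_pos hn0 (nu_pos n)
  have hA : 0 < n - (n + α) / p := by
    rw [sub_pos, div_lt_iff₀ hp0]; linarith
  set γ : ℝ := (n + α) / p - ε with hγ
  set k : ℝ := n / (n - γ) with hk
  have hkpos : 0 < k := div_pos hn0 (by rw [hγ]; linarith)
  set h : ℝ → ℝ := (Iic (1 : ℝ)).indicator (fun r => r ^ (-γ)) with hh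
  set I : ℝ≥0∞ := ∫⁻ r in Ioi (0 : ℝ), ENNReal.ofReal |h r| ^ p *
        ENNReal.ofReal (r ^ ((n : ℝ) - 1 + α)) with hI
  have hIv : I = ENNReal.ofReal (1 / (ε * p)) := by
    have h1 := lint_rpow_aux (ε * p - 1) (by nlinarith)
    rw [sub_add_cancel] at h1
    rw [hI, ← h1, ← Ioi_inter_Iic, inter_comm, ← Measure.restrict_restrict measurableSet_Iic,
      ← lintegral_indicator measurableSet_Iic]
    refine setLIntegral_congr_fun measurableSet_Ioi fun r hr => ?_
    have hr0 : 0 < r := hr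
    by_cases hr1 : r ≤ 1
    · simp only [hh, indicator, mem_Iic, hr1, if_true]
      rw [abs_of_pos (Real.rpow_pos_of_pos hr0 _),
        ENNReal.ofReal_rpow_of_nonneg (by positivity) hp0.le, ← Real.rpow_mul hr0.le,
        ← ENNReal.ofReal_mul (by positivity), ← Real.rpow_add hr0]
      congr 2
      rw [hγ]; field_simp; ring
    · simp [hh, indicator, hr1, hp0]
  have hhm : Measurable h := (by fun_prop : Measurable fun r : ℝ => r ^ (-γ)).indicator
    measurableSet_Iic
  have hN := radial_norm n p pt₁ α hp0 hpt₁0 (fun x => h ‖x‖) h (fun _ => rfl)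
  have hN2 := radial_norm n p pt α hp0 hpt0 (fun x => k * h ‖x‖) (fun r => k * h r) (fun _ => rfl)
  rw [← hI, ← hw] at hN
  have hkI : (∫⁻ r in Ioi (0 : ℝ), ENNReal.ofReal |k * h r| ^ p *
        ENNReal.ofReal (r ^ ((n : ℝ) - 1 + α))) = ENNReal.ofReal k ^ p * I := by
    rw [hI, ← lintegral_const_mul' _ _
      (ENNReal.rpow_ne_top_of_nonneg hp0.le ENNReal.ofReal_ne_top)]
    refine lintegral_congr fun r => ?_
    rw [abs_mul, abs_of_pos hkpos, ENNReal.ofReal_mul hkpos.le,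
      ENNReal.mul_rpow_of_nonneg _ _ hp0.le, mul_assoc]
  rw [hkI, ENNReal.mul_rpow_of_nonneg _ _ (by positivity), ← ENNReal.rpow_mul,
    mul_one_div_cancel hp0.ne', ENNReal.rpow_one, ← hw] at hN2
  have hJ0 : I ^ (1 / p) ≠ 0 := by
    rw [hIv, ENNReal.ofReal_rpow_of_pos (by positivity)]
    simp only [ne_eq, ENNReal.ofReal_eq_zero, not_le]
    positivity
  have hJt : I ^ (1 / p) ≠ ⊤ :=
    ENNReal.rpow_ne_top_of_nonneg (by positivity) (by rw [hIv]; exact ENNReal.ofReal_ne_top)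
  have hle : mixedNormW n p pt α (fun x => k * h ‖x‖) ≤
      mixedNormW n p pt α (sphericalHardy n (fun x => h ‖x‖)) := by
    refine mixed_mono n p pt α hp0 hpt0 _ _ fun x hx => ?_
    by_cases hx1 : ‖x‖ ≤ 1
    · rw [hh, hardy_power n (by omega) γ (by rw [hγ]; linarith) x hx hx1]
      simp [indicator, hx1, hk]
    · simp [hh, indicator, hx1]
  have hfin := hC (fun x => h ‖x‖) (hhm.comp measurable_norm) (by
    rw [hN]
    exact (ENNReal.mul_ne_top (ENNReal.rpow_ne_top_of_nonneg (by positivity)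
      ENNReal.ofReal_ne_top) hJt).lt_top)
  have hfin2 := hle.trans hfin
  rw [hN2, hN, ← mul_assoc, ← mul_assoc, ENNReal.mul_le_mul_iff_left hJ0 hJt,
    ENNReal.ofReal_rpow_of_pos hw0, ENNReal.ofReal_rpow_of_pos hw0] at hfin2
  have hw1 : 0 < w ^ (1 / pt₁) := Real.rpow_pos_of_pos hw0 _
  rw [show (n : ℝ) - (n + α) / p + ε = n - γ by rw [hγ]; ring, ← hk]
  have hc0 : ENNReal.ofReal (w ^ (1 / pt₁)) ≠ 0 := by simpa using hw1
  rw [← ENNReal.mul_le_mul_iff_left hc0 ENNReal.ofReal_ne_top]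
  refine le_trans (le_of_eq ?_) hfin2
  rw [← ENNReal.ofReal_mul (by positivity), ← ENNReal.ofReal_mul (by positivity)]
  congr 1
  rw [Real.rpow_sub hw0]
  field_simp

/-- The spherical Hardy operator maps `L^p_{rad}L^{p̃₁}_{ang}(ℝⁿ, r^α)` to
`L^p_{rad}L^{p̃}_{ang}(ℝⁿ, r^α)` with operator norm exactly
`ω_n^{1/p̃ − 1/p̃₁} · pn/(pn − n − α)`. -/
theorem sphericalHardy_mixed_weighted_norm (n : ℕ) (hn : 2 ≤ n) (p pt pt₁ α : ℝ)
    (hp : 1 < p) (hpt : 1 < pt) (hpt₁ : 1 < pt₁) (hα : α < n * (p - 1)) :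
    (∀ f : EuclideanSpace ℝ (Fin n) → ℝ, Measurable f → mixedNormW n p pt₁ α f < ⊤ →
      mixedNormW n p pt α (sphericalHardy n f)
        ≤ ENNReal.ofReal ((n * nu n) ^ (1 / pt - 1 / pt₁) *
            (p * n / (p * n - n - α))) * mixedNormW n p pt₁ α f) ∧
    (∀ C : ℝ≥0∞,
      (∀ f : EuclideanSpace ℝ (Fin n) → ℝ, Measurable f → mixedNormW n p pt₁ α f < ⊤ →
        mixedNormW n p pt α (sphericalHardy n f) ≤ C * mixedNormW n p pt₁ α f) →
      ENNReal.ofReal ((n * nu n) ^ (1 / pt - 1 / pt₁) *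
          (p * n / (p * n - n - α))) ≤ C) := by

  refine ⟨fun f hf _ => upper_aux n hn p pt pt₁ α hp hpt hpt₁ hα f hf, fun C hC => ?_⟩
  have hp0 : 0 < p := by linarith
  have hA : 0 < n - (n + α) / p := by
    rw [sub_pos, div_lt_iff₀ hp0]; linarith
  have hK : p * n / (p * n - n - α) = n / (n - (n + α) / p + 0) := by
    have : p * n - n - α = p * (n - (n + α) / p) := by field_simp; ring
    rw [this, add_zero]; field_simp
  rw [hK]
  have hcont : Filter.Tendsto (fun ε : ℝ => ENNReal.ofReal ((n * nu n) ^ (1 / pt - 1 / pt₁) *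
      (n / (n - (n + α) / p + ε)))) (nhdsWithin 0 (Ioi 0))
      (nhds (ENNReal.ofReal ((n * nu n) ^ (1 / pt - 1 / pt₁) *
        (n / (n - (n + α) / p + 0))))) := by
    refine ENNReal.tendsto_ofReal (Filter.Tendsto.const_mul _ ?_)
    refine Filter.Tendsto.div tendsto_const_nhds ?_ (by linarith)
    exact Filter.Tendsto.mono_left (tendsto_const_nhds.add Filter.tendsto_id) nhdsWithin_le_nhds
  refine le_of_tendsto hcont ?_
  filter_upwards [self_mem_nhdsWithin] with ε hε
  exact lower_aux n hn p pt pt₁ α hp hpt hpt₁ hα C hC ε hε
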